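/- Let π_RPR(n) denote the number of RPR-primes not exceeding n and π(n) the number of primes not exceeding n. Then liminf_{n→∞} π_RPR(n)/π(n) ≥ 1/2. -/

import Mathlib

/-- `nthPrime n` is the n-th prime with 1-based indexing: p_1 = 2, p_2 = 3, ... -/
noncomputable def nthPrime (n : ℕ) : ℕ := Nat.nth Nat.Prime (n - 1)

/-- An RPR-prime: either 2, or an odd prime p = p_n satisfying Condition 1, i.e.
every integer k with (p+1)/2 ≤ k ≤ (p_{n+1}-1)/2 is composite. -/
def IsRPR (p : ℕ) : Prop :=
  p = 2 ∨ (p.Prime ∧ Odd p ∧ ∀ n : ℕ, p = nthPrime n →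
    ∀ k : ℕ, (p + 1) / 2 ≤ k → k ≤ (nthPrime (n + 1) - 1) / 2 → ¬ k.Prime)

/-- π_RPR(n): the number of RPR-primes not exceeding n. -/
noncomputable def countRPR (n : ℕ) : ℕ :=
  letI := Classical.decPred IsRPR
  ((Finset.range (n + 1)).filter IsRPR).card

theorem exists_prime_double_between_of_not_isRPR {p : ℕ} (hp : p.Prime) (h : ¬ IsRPR p) :
    ∃ k : ℕ, k.Prime ∧ p < 2 * k ∧ ∀ q : ℕ, q.Prime → p < q → 2 * k < q := by
  obtain ⟨h2, h⟩ := not_or.1 h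
  push Not at h
  obtain ⟨n, rfl, k, hk1, hk2, hk⟩ := h hp (hp.odd_of_ne_two h2)
  have hn : n ≠ 0 := by
    rintro rfl
    exact h2 (by simp [nthPrime, Nat.nth_prime_zero_eq_two])
  obtain ⟨m, rfl⟩ := Nat.exists_eq_succ_of_ne_zero hn
  have hodd := hp.odd_of_ne_two h2
  refine ⟨k, hk, by grind, fun q hq hlt ↦ ?_⟩
  have hle : nthPrime (m + 1 + 1) ≤ q := by
    have h1 : nthPrime (m + 1) = Nat.nth Nat.Prime m := rfl
    have h3 : nthPrime (m + 1 + 1) = Nat.nth Nat.Prime (m + 1) := rfl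
    rw [Nat.succ_eq_add_one, h1, ← Nat.nth_count hq,
      Nat.nth_lt_nth Nat.infinite_setOfPred_prime] at hlt
    rw [h3, ← Nat.nth_count hq]
    exact (Nat.nth_le_nth Nat.infinite_setOfPred_prime).2 hlt
  have := hq.two_le
  have := hk.pos
  grind

theorem primeCounting_eq_card_filter (n : ℕ) :
    Nat.primeCounting n = ((Finset.range (n + 1)).filter Nat.Prime).card := by
  simp [Nat.primeCounting, Nat.primeCounting', Nat.count_eq_card_filter_range]

theorem countRPR_le_primeCounting (n : ℕ) : countRPR n ≤ Nat.primeCounting n := by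
  classical
  rw [primeCounting_eq_card_filter, countRPR]
  refine Finset.card_le_card fun p hp ↦ ?_
  simp only [Finset.mem_filter] at hp ⊢
  exact ⟨hp.1, hp.2.elim (fun h ↦ h ▸ Nat.prime_two) And.left⟩

theorem primeCounting_le_countRPR_add (n : ℕ) :
    Nat.primeCounting n ≤ countRPR n + (Nat.primeCounting (n / 2) + 1) := by
  classical
  choose! k hk hpk hkq using fun p (hp : p.Prime ∧ ¬ IsRPR p) ↦
    exists_prime_double_between_of_not_isRPR hp.1 hp.2
  have hsplit := Finset.card_filter_add_card_filter_not
    (s := (Finset.range (n + 1)).filter Nat.Prime) IsRPR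
  have h1 : (((Finset.range (n + 1)).filter Nat.Prime).filter IsRPR).card ≤ countRPR n := by
    unfold countRPR
    rw [Finset.filter_filter]
    refine Finset.card_le_card fun p hp ↦ ?_
    simp only [Finset.mem_filter] at hp ⊢
    exact ⟨hp.1, hp.2.2⟩
  have h2 : (((Finset.range (n + 1)).filter Nat.Prime).filter (¬ IsRPR ·)).card ≤
      Nat.primeCounting (n / 2) + 1 := by
    rw [primeCounting_eq_card_filter]
    refine le_trans (Finset.card_le_card_of_injOn (fun p ↦ if 2 * k p ≤ n then k p else 0)
      (t := insert 0 ((Finset.range (n / 2 + 1)).filter Nat.Prime)) ?_ ?_)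
      (Finset.card_insert_le _ _)
    · intro p hp
      simp only [Finset.coe_filter, Finset.mem_filter, Finset.mem_range, Set.mem_ofPred_eq] at hp
      have := hk p ⟨hp.1.2, hp.2⟩
      simp only [Finset.coe_insert, Finset.coe_filter, Finset.mem_range, Set.mem_insert_iff,
        Set.mem_ofPred_eq]
      split_ifs with h
      · exact Or.inr ⟨by omega, this⟩
      · exact Or.inl rfl
    · have key : ∀ p q : ℕ, p.Prime ∧ ¬ IsRPR p → q.Prime ∧ ¬ IsRPR q → q ≤ n → p < q →
          (if 2 * k p ≤ n then k p else 0) ≠ if 2 * k q ≤ n then k q else 0 := by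
        intro p q hp hq hqn hpq
        have h1 := hkq p hp q hq.1 hpq
        have h2 := hpk q hq
        have h3 := (hk p hp).pos
        grind
      intro p hp q hq hpq
      simp only [Finset.coe_filter, Finset.mem_filter, Finset.mem_range, Set.mem_ofPred_eq] at hp hq
      rcases lt_trichotomy p q with h | h | h
      · exact absurd hpq (key p q ⟨hp.1.2, hp.2⟩ ⟨hq.1.2, hq.2⟩ (by omega) h)
      · exact h
      · exact absurd hpq.symm (key q p ⟨hq.1.2, hq.2⟩ ⟨hp.1.2, hp.2⟩ (by omega) h)
  rw [primeCounting_eq_card_filter]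
  omega

section PrimeNumberTheorem

open Filter Topology MeasureTheory Complex

/-- The Fejér kernel `v ↦ (sin (v / 2) / (v / 2)) ^ 2`, whose Fourier transform is a tent. -/
noncomputable def fejerKernel (v : ℝ) : ℝ := Real.sinc (v / 2) ^ 2

theorem continuous_fejerKernel : Continuous fejerKernel := by
  unfold fejerKernel
  fun_prop

theorem fejerKernel_nonneg (v : ℝ) : 0 ≤ fejerKernel v := sq_nonneg _

theorem integrable_fejerKernel : Integrable fejerKernel := by
  refine (integrable_inv_one_add_sq.const_mul 5).mono'
    continuous_fejerKernel.aestronglyMeasurable (ae_of_all _ fun v ↦ ?_)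
  rw [Real.norm_of_nonneg (fejerKernel_nonneg v), ← div_eq_mul_inv, le_div_iff₀ (by positivity)]
  have h1 : Real.sinc (v / 2) ^ 2 ≤ 1 := (sq_le_one_iff_abs_le_one _).2 (Real.abs_sinc_le_one _)
  have h2 : Real.sinc (v / 2) ^ 2 * v ^ 2 ≤ 4 := by
    rcases eq_or_ne v 0 with rfl | hv
    · simp
    · rw [Real.sinc_of_ne_zero (by positivity)]
      have := Real.sin_sq_le_one (v / 2)
      field_simp
      linarith
  unfold fejerKernel
  linarith

theorem integral_fejerKernel_pos : 0 < ∫ v, fejerKernel v :=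
  integral_pos_of_integrable_nonneg_nonzero (x := 0) continuous_fejerKernel
    integrable_fejerKernel fejerKernel_nonneg (by simp [fejerKernel])

theorem integral_one_sub_mul_exp {c : ℂ} (hc : c ≠ 0) :
    ∫ u : ℝ in (0 : ℝ)..1, (1 - u : ℂ) * exp (c * u) = exp c / c ^ 2 - 1 / c - 1 / c ^ 2 := by
  have hderiv (u : ℝ) : HasDerivAt (fun u : ℝ ↦ ((1 - u : ℂ) / c + 1 / c ^ 2) * exp (c * u))
      ((1 - u : ℂ) * exp (c * u)) u := by
    have h1 : HasDerivAt (fun u : ℂ ↦ ((1 - u : ℂ) / c + 1 / c ^ 2) * exp (c * u))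
        (((0 - 1) / c + 0) * exp (c * u) + ((1 - u : ℂ) / c + 1 / c ^ 2) * (exp (c * u) * (c * 1)))
        (u : ℂ) := by
      refine HasDerivAt.mul ?_ ((hasDerivAt_id' _).const_mul c).cexp
      exact (((hasDerivAt_const _ _).sub (hasDerivAt_id' _)).div_const c).add (hasDerivAt_const _ _)
    convert h1.comp_ofReal using 1
    field_simp
    ring
  rw [intervalIntegral.integral_eq_sub_of_hasDerivAt (fun u _ ↦ hderiv u)
    (Continuous.intervalIntegrable (by fun_prop) _ _)]
  simp
  ring

theorem integral_tent_mul_exp (v : ℝ) :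
    ∫ u : ℝ in (-1 : ℝ)..1, (1 - |u| : ℝ) * exp (u * v * I) = fejerKernel v := by
  have hint (a b : ℝ) : IntervalIntegrable
      (fun u : ℝ ↦ ((1 - |u| : ℝ) : ℂ) * exp (u * v * I)) volume a b :=
    Continuous.intervalIntegrable (by fun_prop) _ _
  rw [← intervalIntegral.integral_add_adjacent_intervals (hint (-1) 0) (hint 0 1)]
  have hneg : ∫ u : ℝ in (-1 : ℝ)..0, ((1 - |u| : ℝ) : ℂ) * exp (u * v * I) =
      ∫ u : ℝ in (0 : ℝ)..1, (1 - u : ℂ) * exp (-(v * I) * u) := by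
    have := intervalIntegral.integral_comp_neg (a := 0) (b := 1)
      fun u : ℝ ↦ ((1 - |u| : ℝ) : ℂ) * exp (u * v * I)
    rw [neg_zero] at this
    rw [← this]
    refine intervalIntegral.integral_congr fun u hu ↦ ?_
    rw [Set.uIcc_of_le zero_le_one] at hu
    simp only [abs_neg, abs_of_nonneg hu.1]
    push_cast
    ring_nf
  have hpos : ∫ u : ℝ in (0 : ℝ)..1, ((1 - |u| : ℝ) : ℂ) * exp (u * v * I) =
      ∫ u : ℝ in (0 : ℝ)..1, (1 - u : ℂ) * exp (v * I * u) := by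
    refine intervalIntegral.integral_congr fun u hu ↦ ?_
    rw [Set.uIcc_of_le zero_le_one] at hu
    simp only [abs_of_nonneg hu.1]
    push_cast
    ring_nf
  rw [hneg, hpos]
  rcases eq_or_ne v 0 with rfl | hv
  · have : ∫ u : ℝ in (0 : ℝ)..1, (1 - u : ℂ) = ((1 / 2 : ℝ) : ℂ) := by
      have : ∫ u : ℝ in (0 : ℝ)..1, (1 - u : ℝ) = 1 / 2 := by
        rw [intervalIntegral.integral_sub (by simp) (by simp)]
        norm_num
      rw [← this, ← intervalIntegral.integral_ofReal]
      push_cast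
      rfl
    norm_num [fejerKernel, this]
  · have hv' : (v : ℂ) ≠ 0 := by exact_mod_cast hv
    have hc : (v * I : ℂ) ≠ 0 := mul_ne_zero hv' I_ne_zero
    rw [integral_one_sub_mul_exp hc, integral_one_sub_mul_exp (neg_ne_zero.2 hc), fejerKernel,
      Real.sinc_of_ne_zero (by positivity)]
    have h1 : Real.sin (v / 2) ^ 2 = (1 - Real.cos v) / 2 := by
      rw [Real.sin_sq_eq_half_sub]
      ring_nf
    have h2 : exp (v * I) + exp (-(v * I)) = 2 * Complex.cos v := by
      rw [Complex.cos]
      ring_nf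
    rw [div_pow, h1]
    push_cast
    have h3 : exp (-(v * I)) = 2 * Complex.cos v - exp (v * I) := by rw [← h2]; ring
    rw [h3]
    have hI : (v * I : ℂ) ^ 2 = - v ^ 2 := by rw [mul_pow, I_sq]; ring
    rw [neg_sq, hI]
    field_simp
    ring

/-- The smoothed mean of a bounded function against a Fejér kernel, damped by `exp (-σ t)`,
in terms of its Laplace transform on the line `re z = σ`. -/
theorem integral_mul_exp_mul_fejerKernel {f : ℝ → ℝ} {M : ℝ} {G : ℂ → ℂ} (hf : Measurable f)
    (hM : ∀ t, |f t| ≤ M)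
    (hG : ∀ z : ℂ, 0 < z.re → ∫ t : ℝ in Set.Ioi 0, f t * exp (-z * t) = G z)
    (l x : ℝ) {σ : ℝ} (hσ : 0 < σ) :
    ∫ t : ℝ in Set.Ioi 0, f t * exp (-σ * t) * fejerKernel (l * (x - t)) =
      ∫ u : ℝ in (-1 : ℝ)..1, (1 - |u| : ℝ) * exp (u * (l * x) * I) * G (σ + l * u * I) := by
  have hbase : Integrable (fun t : ℝ ↦ (f t : ℂ) * exp (-σ * t)) (volume.restrict (Set.Ioi 0)) := by
    refine Integrable.mono' ((integrableOn_exp_mul_Ioi (neg_neg_of_pos hσ) 0).const_mul M)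
      (by fun_prop) (ae_of_all _ fun t ↦ ?_)
    rw [norm_mul, norm_real, Real.norm_eq_abs, norm_exp]
    simp only [mul_re, neg_re, ofReal_re, neg_im, ofReal_im, neg_zero, sub_zero, mul_zero]
    gcongr
    exact hM t
  have htent : Integrable (fun u : ℝ ↦ ((1 - |u| : ℝ) : ℂ))
      (volume.restrict (Set.Ioc (-1 : ℝ) 1)) :=
    (Continuous.intervalIntegrable (by fun_prop) (-1) 1).1
  have hprod : Integrable (fun p : ℝ × ℝ ↦
      (f p.1 * exp (-σ * p.1)) * ((1 - |p.2| : ℝ) : ℂ) * exp (p.2 * (l * (x - p.1) : ℝ) * I))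
      ((volume.restrict (Set.Ioi 0)).prod (volume.restrict (Set.Ioc (-1 : ℝ) 1))) := by
    refine (hbase.mul_prod htent).mul_bdd (c := 1) (by fun_prop) (ae_of_all _ fun p ↦ ?_)
    rw [← ofReal_mul, norm_exp_ofReal_mul_I]
  calc
    _ = ∫ t : ℝ in Set.Ioi 0, ∫ u : ℝ in Set.Ioc (-1 : ℝ) 1,
        (f t * exp (-σ * t)) * ((1 - |u| : ℝ) : ℂ) * exp (u * (l * (x - t) : ℝ) * I) := by
      refine integral_congr_ae (ae_of_all _ fun t ↦ ?_)
      simp only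
      rw [← integral_tent_mul_exp, intervalIntegral.integral_of_le (by norm_num),
        ← integral_const_mul]
      simp only [mul_assoc]
    _ = ∫ u : ℝ in Set.Ioc (-1 : ℝ) 1, ∫ t : ℝ in Set.Ioi 0,
        (f t * exp (-σ * t)) * ((1 - |u| : ℝ) : ℂ) * exp (u * (l * (x - t) : ℝ) * I) :=
      integral_integral_swap hprod
    _ = _ := by
      rw [intervalIntegral.integral_of_le (by norm_num)]
      refine integral_congr_ae (ae_of_all _ fun u ↦ ?_)
      simp only
      rw [← hG _ (by simpa using hσ), ← integral_const_mul]
      refine integral_congr_ae (ae_of_all _ fun t ↦ ?_)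
      simp only
      have : exp (-σ * t) * exp (u * (l * (x - t) : ℝ) * I) =
          exp (u * (l * x) * I) * exp (-(σ + l * u * I) * t) := by
        rw [← Complex.exp_add, ← Complex.exp_add]
        push_cast
        ring_nf
      linear_combination ((1 - |u| : ℝ) : ℂ) * f t * this

theorem integrable_fejerKernel_comp {l : ℝ} (hl : l ≠ 0) (x : ℝ) :
    Integrable (fun t ↦ fejerKernel (l * (x - t))) :=
  (integrable_fejerKernel.comp_mul_left' hl).comp_sub_left x

theorem integral_mul_fejerKernel {f : ℝ → ℝ} {M : ℝ} {G : ℂ → ℂ} (hf : Measurable f)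
    (hM : ∀ t, |f t| ≤ M) (hGc : ContinuousOn G {z | 0 ≤ z.re})
    (hG : ∀ z : ℂ, 0 < z.re → ∫ t : ℝ in Set.Ioi 0, f t * exp (-z * t) = G z)
    {l : ℝ} (hl : l ≠ 0) (x : ℝ) :
    ∫ t : ℝ in Set.Ioi 0, (f t : ℂ) * fejerKernel (l * (x - t)) =
      ∫ u : ℝ in (-1 : ℝ)..1, (1 - |u| : ℝ) * exp (u * (l * x) * I) * G (l * u * I) := by
  have hker : Measurable fejerKernel := continuous_fejerKernel.measurable
  have hleft : Tendsto (fun σ : ℝ ↦ ∫ t : ℝ in Set.Ioi 0,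
      f t * exp (-σ * t) * fejerKernel (l * (x - t))) (𝓝[>] 0)
      (𝓝 (∫ t : ℝ in Set.Ioi 0, (f t : ℂ) * fejerKernel (l * (x - t)))) := by
    refine tendsto_integral_filter_of_dominated_convergence
      (fun t ↦ M * fejerKernel (l * (x - t))) (Eventually.of_forall fun σ ↦ by fun_prop) ?_
      ((integrable_fejerKernel_comp hl x).integrableOn.const_mul M) (ae_of_all _ fun t ↦ ?_)
    · filter_upwards [self_mem_nhdsWithin] with σ hσ
      filter_upwards [ae_restrict_mem measurableSet_Ioi] with t ht
      rw [norm_mul, norm_mul, norm_real, norm_real, Real.norm_eq_abs,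
        Real.norm_of_nonneg (fejerKernel_nonneg _), norm_exp]
      refine mul_le_mul_of_nonneg_right ?_ (fejerKernel_nonneg _)
      have : Real.exp (-σ * t : ℂ).re ≤ 1 := by
        rw [Real.exp_le_one_iff]
        simpa using mul_nonneg (le_of_lt hσ) (le_of_lt ht)
      exact (mul_le_of_le_one_right (abs_nonneg _) this).trans (hM t)
    · have : Continuous fun σ : ℝ ↦ (f t : ℂ) * exp (-σ * t) * fejerKernel (l * (x - t)) := by
        fun_prop
      simpa using (this.tendsto 0).mono_left nhdsWithin_le_nhds
  have hright : Tendsto (fun σ : ℝ ↦ ∫ u : ℝ in (-1 : ℝ)..1,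
      (1 - |u| : ℝ) * exp (u * (l * x) * I) * G (σ + l * u * I)) (𝓝[>] 0)
      (𝓝 (∫ u : ℝ in (-1 : ℝ)..1, (1 - |u| : ℝ) * exp (u * (l * x) * I) * G (l * u * I))) := by
    have hcont : ContinuousOn (fun p : ℝ × ℝ ↦ ((1 - |p.2| : ℝ) : ℂ) * exp (p.2 * (l * x) * I) *
        G (p.1 + l * p.2 * I)) (Set.Icc 0 1 ×ˢ Set.Icc (-1) 1) := by
      refine ContinuousOn.mul (Continuous.continuousOn (by fun_prop)) (hGc.comp
        (Continuous.continuousOn (by fun_prop)) fun p hp ↦ ?_)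
      simpa using hp.1.1
    obtain ⟨C, hC⟩ := (isCompact_Icc.prod isCompact_Icc).exists_bound_of_continuousOn hcont
    have hIcc : Set.Icc (0 : ℝ) 1 ∈ 𝓝[>] (0 : ℝ) := Icc_mem_nhdsGT one_pos
    simp only [intervalIntegral.integral_of_le (show (-1 : ℝ) ≤ 1 by norm_num)]
    refine tendsto_integral_filter_of_dominated_convergence (fun _ ↦ C) ?_ ?_
      (integrable_const C) ?_
    · filter_upwards [hIcc] with σ hσ
      refine ContinuousOn.aestronglyMeasurable ?_ measurableSet_Ioc
      exact hcont.comp (f := fun u : ℝ ↦ (σ, u)) (by fun_prop)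
        fun u hu ↦ ⟨hσ, Set.Ioc_subset_Icc_self hu⟩
    · filter_upwards [hIcc] with σ hσ
      filter_upwards [ae_restrict_mem measurableSet_Ioc] with u hu
      exact hC (σ, u) ⟨hσ, Set.Ioc_subset_Icc_self hu⟩
    · filter_upwards [ae_restrict_mem measurableSet_Ioc] with u hu
      have h0 : ((0 : ℝ), u) ∈ Set.Icc (0 : ℝ) 1 ×ˢ Set.Icc (-1 : ℝ) 1 :=
        ⟨⟨le_rfl, zero_le_one⟩, Set.Ioc_subset_Icc_self hu⟩
      have ht : Tendsto (fun σ : ℝ ↦ (σ, u)) (𝓝[>] 0)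
          (𝓝[Set.Icc (0 : ℝ) 1 ×ˢ Set.Icc (-1 : ℝ) 1] (0, u)) := by
        refine tendsto_nhdsWithin_iff.2 ⟨?_, ?_⟩
        · exact ((Continuous.prodMk_left u).tendsto 0).mono_left nhdsWithin_le_nhds
        · filter_upwards [hIcc] with σ hσ using ⟨hσ, h0.2⟩
      simpa [Function.comp_def] using (hcont _ h0).tendsto.comp ht
  refine tendsto_nhds_unique hleft (hright.congr' ?_)
  filter_upwards [self_mem_nhdsWithin] with σ hσ
  exact (integral_mul_exp_mul_fejerKernel hf hM hG l x hσ).symm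

theorem tendsto_integral_mul_fejerKernel {f : ℝ → ℝ} {M : ℝ} {G : ℂ → ℂ} (hf : Measurable f)
    (hM : ∀ t, |f t| ≤ M) (hGc : ContinuousOn G {z | 0 ≤ z.re})
    (hG : ∀ z : ℂ, 0 < z.re → ∫ t : ℝ in Set.Ioi 0, f t * exp (-z * t) = G z)
    {l : ℝ} (hl : 0 < l) :
    Tendsto (fun x ↦ ∫ t : ℝ in Set.Ioi 0, f t * fejerKernel (l * (x - t))) atTop (𝓝 0) := by
  have hRL := Real.tendsto_integral_exp_smul_cocompact
    (Set.indicator (Set.Ioc (-1 : ℝ) 1) fun u : ℝ ↦ ((1 - |u| : ℝ) : ℂ) * G (l * u * I))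
  have hx : Tendsto (fun x : ℝ ↦ -(l / (2 * Real.pi)) * x) atTop (cocompact ℝ) :=
    (tendsto_id.const_mul_atTop_of_neg (by simp; positivity)).mono_right atBot_le_cocompact
  rw [← tendsto_ofReal_iff]
  refine ((hRL.comp hx).congr fun x ↦ ?_)
  rw [← integral_complex_ofReal]
  push_cast
  rw [integral_mul_fejerKernel hf hM hGc hG hl.ne' x,
    intervalIntegral.integral_of_le (by norm_num), ← integral_indicator measurableSet_Ioc]
  refine integral_congr_ae (ae_of_all _ fun u ↦ ?_)
  by_cases hu : u ∈ Set.Ioc (-1 : ℝ) 1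
  · simp only [Set.indicator_of_mem hu, Circle.smul_def, Real.fourierChar_apply, smul_eq_mul]
    have : ((2 * Real.pi * -(u * (-(l / (2 * Real.pi)) * x)) : ℝ) : ℂ) = u * (l * x) := by
      rw [← ofReal_mul, ← ofReal_mul]
      congr 1
      field_simp
    rw [this]
    push_cast
    ring
  · simp [Set.indicator_of_notMem hu]

theorem integral_fejerKernel_comp {l : ℝ} (hl : 0 < l) (y : ℝ) :
    ∫ t, fejerKernel (l * (y - t)) = l⁻¹ * ∫ v, fejerKernel v := by
  rw [integral_sub_left_eq_self (fun t ↦ fejerKernel (l * t)) volume y,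
    Measure.integral_comp_mul_left, abs_of_pos (inv_pos.2 hl), smul_eq_mul]

/-- A bounded function whose Fejér means tend to zero cannot stay above `ε` on
intervals of fixed length far out. -/
theorem eventually_exists_lt_of_tendsto_integral_mul_fejerKernel {f : ℝ → ℝ} {M : ℝ}
    (hf : Measurable f) (hM : ∀ t, |f t| ≤ M)
    (hlim : ∀ l : ℝ, 0 < l →
      Tendsto (fun x ↦ ∫ t : ℝ in Set.Ioi 0, f t * fejerKernel (l * (x - t))) atTop (𝓝 0))
    {ε h : ℝ} (hε : 0 < ε) (hh : 0 < h) :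
    ∀ᶠ x in atTop, ∃ t ∈ Set.Icc x (x + h), f t < ε := by
  have hM0 : 0 ≤ M := (abs_nonneg _).trans (hM 0)
  set c := ∫ v, fejerKernel v
  have hc0 : 0 < c := integral_fejerKernel_pos
  obtain ⟨l, hl, hmass⟩ : ∃ l : ℝ, 0 < l ∧
      M * c + ε * c / 2 < (ε + M) * ∫ v in -(l * (h / 2))..l * (h / 2), fejerKernel v := by
    have hb : Tendsto (fun l : ℝ ↦ l * (h / 2)) atTop atTop :=
      tendsto_id.atTop_mul_const (by positivity)
    have := (intervalIntegral_tendsto_integral integrable_fejerKernel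
      (tendsto_neg_atTop_atBot.comp hb) hb).const_mul (ε + M)
    have hlt : M * c + ε * c / 2 < (ε + M) * c := by nlinarith
    obtain ⟨l, h1, h2⟩ := ((eventually_gt_atTop 0).and (this.eventually_const_lt hlt)).exists
    exact ⟨l, h1, h2⟩
  have hsmall := ((hlim l hl).comp
    (tendsto_atTop_add_const_right _ (h / 2) tendsto_id)).eventually_lt_const
    (show 0 < l⁻¹ * (ε * c / 2) by positivity)
  filter_upwards [hsmall, eventually_gt_atTop 0] with x hx hx0
  by_contra! hcon
  set y := x + h / 2 with hy
  have hK : Integrable (fun t ↦ fejerKernel (l * (y - t))) := integrable_fejerKernel_comp hl.ne' y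
  have hnn (t : ℝ) : 0 ≤ fejerKernel (l * (y - t)) := fejerKernel_nonneg _
  have hnear : ∫ t in Set.Icc x (x + h), fejerKernel (l * (y - t)) =
      l⁻¹ * ∫ v in -(l * (h / 2))..l * (h / 2), fejerKernel v := by
    rw [integral_Icc_eq_integral_Ioc, ← intervalIntegral.integral_of_le (by linarith)]
    simp only [mul_sub]
    rw [intervalIntegral.integral_comp_sub_mul _ hl.ne', smul_eq_mul]
    congr 2 <;> rw [hy] <;> ring
  have hfar : ∫ t in Set.Ioi 0, fejerKernel (l * (y - t)) ≤ l⁻¹ * c := by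
    rw [← integral_fejerKernel_comp hl y]
    exact setIntegral_le_integral hK (ae_of_all _ hnn)
  have hind : IntegrableOn ((Set.Icc x (x + h)).indicator fun t ↦ fejerKernel (l * (y - t)))
      (Set.Ioi 0) := (hK.indicator measurableSet_Icc).integrableOn
  have hker : Measurable fejerKernel := continuous_fejerKernel.measurable
  have hfK : IntegrableOn (fun t ↦ f t * fejerKernel (l * (y - t))) (Set.Ioi 0) := by
    refine (hK.integrableOn.const_mul M).mono' (by fun_prop) (ae_of_all _ fun t ↦ ?_)
    rw [norm_mul, Real.norm_of_nonneg (hnn t)]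
    exact mul_le_mul_of_nonneg_right (hM t) (hnn t)
  have hmono : (ε + M) * (∫ t in Set.Ioi 0,
        (Set.Icc x (x + h)).indicator (fun t ↦ fejerKernel (l * (y - t))) t) -
      M * ∫ t in Set.Ioi 0, fejerKernel (l * (y - t)) ≤
      ∫ t in Set.Ioi 0, f t * fejerKernel (l * (y - t)) := by
    rw [← integral_const_mul, ← integral_const_mul,
      ← integral_sub (hind.const_mul _) (hK.integrableOn.const_mul _)]
    refine integral_mono ((hind.const_mul _).sub (hK.integrableOn.const_mul _)) hfK fun t ↦ ?_
    have h1 := neg_le_of_abs_le (hM t)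
    by_cases ht : t ∈ Set.Icc x (x + h)
    · simp only [Set.indicator_of_mem ht]
      nlinarith [hcon t ht, hnn t]
    · simp only [Set.indicator_of_notMem ht]
      nlinarith [hnn t]
  rw [setIntegral_indicator measurableSet_Icc,
    Set.inter_eq_right.2 (Set.Icc_subset_Ioi_iff (by linarith) |>.2 hx0), hnear] at hmono
  have hx' : ∫ t in Set.Ioi 0, f t * fejerKernel (l * (y - t)) < l⁻¹ * (ε * c / 2) := hx
  have h1 := mul_le_mul_of_nonneg_left hfar hM0
  have h2 := mul_lt_mul_of_pos_left hmass (inv_pos.2 hl)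
  linarith

/-- **Wiener–Ikehara theorem** for functions `S` with `S x = O(x)`, in logarithmic scale. -/
theorem tendsto_mul_exp_neg_of_laplace {S : ℝ → ℝ} {M : ℝ} {G : ℂ → ℂ} (hS : Monotone S)
    (hM : ∀ t, |S t * Real.exp (-t) - 1| ≤ M) (hGc : ContinuousOn G {z | 0 ≤ z.re})
    (hG : ∀ z : ℂ, 0 < z.re →
      ∫ t : ℝ in Set.Ioi 0, ((S t * Real.exp (-t) - 1 : ℝ) : ℂ) * exp (-z * t) = G z) :
    Tendsto (fun t ↦ S t * Real.exp (-t)) atTop (𝓝 1) := by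
  set f : ℝ → ℝ := fun t ↦ S t * Real.exp (-t) - 1 with hfdef
  have hf : Measurable f := by
    have := hS.measurable
    fun_prop
  have hlim (l : ℝ) (hl : 0 < l) := tendsto_integral_mul_fejerKernel hf hM hGc hG hl
  have hstep {s t : ℝ} (hst : s ≤ t) : (f s + 1) * Real.exp s ≤ (f t + 1) * Real.exp t := by
    simp only [hfdef, sub_add_cancel, mul_assoc, ← Real.exp_add, neg_add_cancel, Real.exp_zero,
      mul_one]
    exact hS hst
  have hup {ε h : ℝ} (hε : 0 < ε) (hh : 0 < h) :=
    eventually_exists_lt_of_tendsto_integral_mul_fejerKernel hf hM hlim hε hh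
  have hdown {ε h : ℝ} (hε : 0 < ε) (hh : 0 < h) :=
    eventually_exists_lt_of_tendsto_integral_mul_fejerKernel (f := -f) (M := M) hf.neg
      (fun t ↦ by simpa using hM t)
      (fun l hl ↦ by simpa [integral_neg] using (hlim l hl).neg) hε hh
  have hexp (a b : ℝ) : Real.exp a = Real.exp b * Real.exp (a - b) := by
    rw [← Real.exp_add]; ring_nf
  refine Metric.tendsto_nhds.2 fun ε hε ↦ ?_
  wlog hε1 : ε < 1 generalizing ε
  · filter_upwards [this (1 / 2) (by norm_num) (by norm_num)] with x hx
    linarith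
  obtain ⟨h, hh, hbound⟩ : ∃ h : ℝ, 0 < h ∧ Real.exp h * (1 + ε / 2) < 1 + ε ∧
      Real.exp h * (1 - ε) < 1 - ε / 2 := by
    have h1 : Tendsto (fun h ↦ Real.exp h * (1 + ε / 2)) (𝓝[>] 0) (𝓝 (1 + ε / 2)) := by
      have : Continuous fun h ↦ Real.exp h * (1 + ε / 2) := by fun_prop
      simpa using (this.tendsto 0).mono_left nhdsWithin_le_nhds
    have h2 : Tendsto (fun h ↦ Real.exp h * (1 - ε)) (𝓝[>] 0) (𝓝 (1 - ε)) := by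
      have : Continuous fun h ↦ Real.exp h * (1 - ε) := by fun_prop
      simpa using (this.tendsto 0).mono_left nhdsWithin_le_nhds
    obtain ⟨h, h3, h4, h5⟩ := (eventually_mem_nhdsWithin (a := (0 : ℝ)) (s := Set.Ioi 0)).and
      ((h1.eventually_lt_const (by linarith : 1 + ε / 2 < 1 + ε)).and
      (h2.eventually_lt_const (by linarith : 1 - ε < 1 - ε / 2))) |>.exists
    exact ⟨h, h3, h4, h5⟩
  filter_upwards [hup (half_pos hε) hh,
    (tendsto_atTop_add_const_right _ (-h) tendsto_id).eventually (hdown (half_pos hε) hh)]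
    with x ⟨t, ht, hft⟩ ⟨s, hs, hfs⟩
  have hfx : S x * Real.exp (-x) = f x + 1 := by simp [hfdef]
  rw [Real.dist_eq, hfx, add_sub_cancel_right, abs_lt]
  simp only [id, Pi.neg_apply] at hs hfs
  constructor
  · have h1 := hstep (show s ≤ x by linarith [hs.2])
    rw [hexp x s] at h1
    have h2 : f s + 1 ≤ (f x + 1) * Real.exp (x - s) := by
      have := Real.exp_pos s
      nlinarith
    have h3 : Real.exp (x - s) ≤ Real.exp h := Real.exp_le_exp.2 (by linarith [hs.1])
    have h4 := Real.exp_pos (x - s)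
    by_contra! hcon
    nlinarith
  · have h1 := hstep ht.1
    rw [hexp t x] at h1
    have h2 : f x + 1 ≤ (f t + 1) * Real.exp (t - x) := by
      have := Real.exp_pos x
      nlinarith
    have h3 : Real.exp (t - x) ≤ Real.exp h := Real.exp_le_exp.2 (by linarith [ht.2])
    have h4 := Real.exp_pos (t - x)
    nlinarith

theorem image_exp_Ioi_zero : Real.exp '' Set.Ioi 0 = Set.Ioi 1 := by
  ext x
  refine ⟨?_, fun hx ↦ ⟨Real.log x, Real.log_pos hx, Real.exp_log (one_pos.trans hx)⟩⟩
  rintro ⟨t, ht, rfl⟩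
  exact Real.one_lt_exp_iff.2 ht

theorem LSeries_vonMangoldt_eq_integral_psi {s : ℂ} (hs : 1 < s.re) :
    LSeries (fun n ↦ (ArithmeticFunction.vonMangoldt n : ℂ)) s =
      s * ∫ t : ℝ in Set.Ioi 0, Chebyshev.psi (Real.exp t) * exp (-s * t) := by
  have hO : (fun n : ℕ ↦ ∑ k ∈ Finset.Icc 1 n, ArithmeticFunction.vonMangoldt k) =O[atTop]
      fun n ↦ (n : ℝ) ^ (1 : ℝ) := by
    refine Asymptotics.isBigO_of_le' (c := Real.log 4 + 4) _ fun n ↦ ?_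
    have := Chebyshev.psi_le_const_mul_self (n.cast_nonneg : (0 : ℝ) ≤ n)
    have h0 := Chebyshev.psi_nonneg n
    rw [Chebyshev.psi, Nat.floor_natCast] at this h0
    change |∑ k ∈ Finset.Ioc 0 n, ArithmeticFunction.vonMangoldt k| ≤ _
    rw [abs_of_nonneg h0]
    simpa using this
  rw [LSeries_eq_mul_integral_of_nonneg _ zero_le_one hs hO
    fun n ↦ ArithmeticFunction.vonMangoldt_nonneg, ← image_exp_Ioi_zero,
    integral_image_eq_integral_abs_deriv_smul measurableSet_Ioi
      (fun t _ ↦ (Real.hasDerivAt_exp t).hasDerivWithinAt) Real.exp_injective.injOn]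
  congr 1
  refine integral_congr_ae (ae_of_all _ fun t ↦ ?_)
  simp only
  have hpsi : ∑ k ∈ Finset.Icc 1 ⌊Real.exp t⌋₊, (ArithmeticFunction.vonMangoldt k : ℂ) =
      Chebyshev.psi (Real.exp t) := by
    rw [Chebyshev.psi]
    push_cast
    rfl
  rw [hpsi, abs_of_pos (Real.exp_pos t), real_smul, ofReal_exp,
    Complex.cpow_def_of_ne_zero (Complex.exp_ne_zero _), ← ofReal_exp,
    ← ofReal_log (Real.exp_pos t).le, Real.log_exp, ofReal_exp, mul_left_comm, ← Complex.exp_add]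
  ring_nf

theorem tendsto_psi_div_atTop : Tendsto (fun x ↦ Chebyshev.psi x / x) atTop (𝓝 1) := by
  set A := ArithmeticFunction.vonMangoldt.LFunctionResidueClassAux (1 : ZMod 1) with hA
  have hAc : ContinuousOn A {s | 1 ≤ s.re} :=
    ArithmeticFunction.vonMangoldt.continuousOn_LFunctionResidueClassAux 1
  have hAeq {s : ℂ} (hs : 1 < s.re) :
      A s = LSeries (fun n ↦ (ArithmeticFunction.vonMangoldt n : ℂ)) s - 1 / (s - 1) := by
    have := ArithmeticFunction.vonMangoldt.eqOn_LFunctionResidueClassAux (q := 1) (a := 1)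
      isUnit_one hs
    rw [hA, this]
    simp [ArithmeticFunction.vonMangoldt.residueClass, Subsingleton.elim _ (1 : ZMod 1)]
  have hbound (t : ℝ) : |Chebyshev.psi (Real.exp t) * Real.exp (-t) - 1| ≤ Real.log 4 + 5 := by
    have h1 := Chebyshev.psi_le_const_mul_self (Real.exp_pos t).le
    have h2 := Chebyshev.psi_nonneg (Real.exp t)
    have h3 : Real.exp t * Real.exp (-t) = 1 := by rw [← Real.exp_add]; simp
    have h4 := Real.exp_pos (-t)
    have h5 : 0 ≤ Chebyshev.psi (Real.exp t) * Real.exp (-t) := by positivity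
    have h6 := mul_le_mul_of_nonneg_right h1 h4.le
    rw [mul_assoc, h3] at h6
    rw [abs_le]
    constructor <;> linarith
  have hmono : Monotone fun t ↦ Chebyshev.psi (Real.exp t) :=
    Chebyshev.psi_mono.comp Real.exp_monotone
  have hmain : Tendsto (fun t ↦ Chebyshev.psi (Real.exp t) * Real.exp (-t)) atTop (𝓝 1) := by
    refine tendsto_mul_exp_neg_of_laplace (G := fun z ↦ (A (1 + z) - 1) / (1 + z)) hmono hbound
      ?_ fun z hz ↦ ?_
    · refine ContinuousOn.div ((hAc.comp (by fun_prop) fun z hz ↦ ?_).sub continuousOn_const)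
        (by fun_prop) fun z hz h0 ↦ ?_
      · simpa using hz
      · have h1 := congrArg re h0
        have h2 : 0 ≤ z.re := hz
        simp only [add_re, one_re, zero_re] at h1
        linarith
    · have hs : 1 < (1 + z).re := by simpa using hz
      have hs0 : 1 + z ≠ 0 := by
        intro h0
        rw [h0, zero_re] at hs
        linarith
      have hz0 : z ≠ 0 := by
        rintro rfl
        simp at hz
      have hz' : (-z).re < 0 := by simpa using hz
      have hexp : IntegrableOn (fun t : ℝ ↦ exp (-z * t)) (Set.Ioi 0) :=
        integrableOn_exp_mul_complex_Ioi hz' 0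
      have hint : IntegrableOn (fun t : ℝ ↦
          ((Chebyshev.psi (Real.exp t) * Real.exp (-t) - 1 : ℝ) : ℂ) * exp (-z * t))
          (Set.Ioi 0) := by
        have := hmono.measurable
        refine hexp.bdd_mul (c := Real.log 4 + 5) (by fun_prop) (ae_of_all _ fun t ↦ ?_)
        rw [norm_real]
        exact hbound t
      have hsum : ∫ t : ℝ in Set.Ioi 0, Chebyshev.psi (Real.exp t) * exp (-(1 + z) * t) =
          (∫ t : ℝ in Set.Ioi 0, ((Chebyshev.psi (Real.exp t) * Real.exp (-t) - 1 : ℝ) : ℂ) *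
            exp (-z * t)) + ∫ t : ℝ in Set.Ioi 0, exp (-z * t) := by
        rw [← integral_add hint hexp]
        refine integral_congr_ae (ae_of_all _ fun t ↦ ?_)
        simp only
        rw [show -(1 + z) * t = -t + -z * t by ring, Complex.exp_add]
        push_cast
        ring
      rw [integral_exp_mul_complex_Ioi hz'] at hsum
      have h1 := hAeq hs
      rw [LSeries_vonMangoldt_eq_integral_psi hs, hsum] at h1
      rw [h1]
      simp only [ofReal_zero, mul_zero, Complex.exp_zero, add_sub_cancel_left]
      field_simp
      ring
  refine (hmain.comp Real.tendsto_log_atTop).congr' ?_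
  filter_upwards [eventually_gt_atTop 0] with x hx
  simp [Real.exp_neg, Real.exp_log hx, div_eq_mul_inv]

theorem tendsto_theta_div_atTop : Tendsto (fun x ↦ Chebyshev.theta x / x) atTop (𝓝 1) := by
  have hsqrt : Real.sqrt =o[atTop] fun x : ℝ ↦ x := by
    refine (Asymptotics.isLittleO_iff_tendsto (by rintro x rfl; simp)).2 ?_
    simp_rw [Real.sqrt_div_self']
    exact Real.tendsto_sqrt_atTop.const_div_atTop 1
  have h := (Chebyshev.isBigO_psi_sub_theta_sqrt.trans_isLittleO hsqrt).tendsto_div_nhds_zero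
  simpa [sub_div] using tendsto_psi_div_atTop.sub h

/-- The **prime number theorem**. -/
theorem tendsto_primeCounting_mul_log_div_atTop :
    Tendsto (fun x : ℝ ↦ (Nat.primeCounting ⌊x⌋₊ : ℝ) * Real.log x / x) atTop (𝓝 1) := by
  have h := tendsto_theta_div_atTop.add
    Chebyshev.integral_theta_div_log_sq_isLittleO.tendsto_div_nhds_zero
  rw [add_zero] at h
  refine h.congr' ?_
  filter_upwards [eventually_ge_atTop 2] with x hx
  have hlog : 0 < Real.log x := Real.log_pos (by linarith)
  have hx0 : 0 < x := by linarith
  rw [Chebyshev.primeCounting_eq_theta_div_log_add_integral hx]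
  field_simp

theorem tendsto_primeCounting_half_div_primeCounting :
    Tendsto (fun n : ℕ ↦ (Nat.primeCounting (n / 2) : ℝ) / Nat.primeCounting n) atTop
      (𝓝 (1 / 2)) := by
  have hhalf : Tendsto (fun x : ℝ ↦ x / 2) atTop atTop := tendsto_id.atTop_div_const two_pos
  have hlog : Tendsto (fun x : ℝ ↦ Real.log x / Real.log (x / 2)) atTop (𝓝 1) := by
    have h1 : Tendsto (fun x : ℝ ↦ 1 + Real.log 2 / Real.log (x / 2)) atTop (𝓝 (1 + 0)) :=
      ((Real.tendsto_log_atTop.comp hhalf).const_div_atTop _).const_add 1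
    rw [add_zero] at h1
    refine h1.congr' ?_
    filter_upwards [eventually_gt_atTop 2] with x hx
    have : 0 < Real.log (x / 2) := Real.log_pos (by linarith)
    rw [Real.log_div (by linarith) two_ne_zero] at this ⊢
    field_simp
    ring
  have hpnt := tendsto_primeCounting_mul_log_div_atTop
  have h := (((hpnt.comp hhalf).div hpnt one_ne_zero).mul hlog).mul_const (1 / 2)
  rw [div_one, one_mul, one_mul] at h
  refine (h.comp tendsto_natCast_atTop_atTop).congr' ?_
  filter_upwards [eventually_gt_atTop 2] with n hn
  have hn' : (2 : ℝ) < n := by exact_mod_cast hn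
  have h1 : 0 < Real.log n := Real.log_pos (by linarith)
  have h2 : 0 < Real.log (n / 2) := Real.log_pos (by linarith)
  have h3 : (0 : ℝ) < Nat.primeCounting n := by
    exact_mod_cast Nat.pos_of_ne_zero (mt Nat.primeCounting_eq_zero_iff.1 (by omega))
  have h4 : ⌊(n : ℝ) / 2⌋₊ = n / 2 := by
    simpa using Nat.floor_div_natCast (n : ℝ) 2
  simp only [Function.comp_apply, Pi.div_apply, h4, Nat.floor_natCast]
  field_simp

end PrimeNumberTheorem

open Filter Topology

/-- liminf_{n→∞} π_RPR(n)/π(n) ≥ 1/2. -/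
theorem liminf_RPR_ge_half :
    (1 : ℝ) / 2 ≤
      Filter.liminf (fun n : ℕ => (countRPR n : ℝ) / (Nat.primeCounting n : ℝ))
        Filter.atTop := by
  have hinv : Tendsto (fun n : ℕ ↦ (1 : ℝ) / Nat.primeCounting n) atTop (𝓝 0) :=
    (tendsto_natCast_atTop_atTop.comp Nat.tendsto_primeCounting).const_div_atTop 1
  have hlow : Tendsto (fun n : ℕ ↦ 1 - ((Nat.primeCounting (n / 2) : ℝ) / Nat.primeCounting n +
      1 / Nat.primeCounting n)) atTop (𝓝 (1 / 2)) := by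
    have := (tendsto_primeCounting_half_div_primeCounting.add hinv).const_sub 1
    norm_num at this ⊢
    exact this
  have hbdd : ∀ n : ℕ, (countRPR n : ℝ) / Nat.primeCounting n ≤ 1 := fun n ↦ by
    refine div_le_one_of_le₀ ?_ (Nat.cast_nonneg _)
    exact_mod_cast countRPR_le_primeCounting n
  rw [← hlow.liminf_eq]
  refine liminf_le_liminf ?_ hlow.isBoundedUnder_ge
    (isBoundedUnder_of ⟨1, hbdd⟩ : IsBoundedUnder (· ≤ ·) atTop _).isCoboundedUnder_ge
  filter_upwards [eventually_ge_atTop 2] with n hn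
  have h3 : (0 : ℝ) < Nat.primeCounting n := by
    exact_mod_cast Nat.pos_of_ne_zero (mt Nat.primeCounting_eq_zero_iff.1 (by omega))
  have h4 : (Nat.primeCounting n : ℝ) ≤ countRPR n + (Nat.primeCounting (n / 2) + 1) := by
    exact_mod_cast primeCounting_le_countRPR_add n
  rw [← add_div, one_sub_div h3.ne']
  gcongr
  linarith
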